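/- Let μ be a probability measure on [0,1), let β ∈ (0,1), let u_β ∈ [0,1) satisfy ∫_{[0,1)} max(0, u_β − α)/(1−α) μ(dα) = β, and set p₀ = ((1−u_β)/(1−β))·∫_{[0,u_β]} (1−α)^{-1} μ(dα). Then the measure μ_β := p₀·δ_{u_β} + (1−β)^{-1}·μ restricted to (u_β, 1) is a probability measure, and for every integrable random variable Y with ∫_{[0,1)} AVaR_γ(|Y|) μ(dγ) < ∞, the higher order risk measure of R(Y) = ∫_{[0,1)} AVaR_γ(Y) μ(dγ) satisfies inf_{t ∈ ℝ} ( t + (1−β)^{-1}·∫_{[0,1)} AVaR_γ((Y−t)₊) μ(dγ) ) = ∫_{[0,1)} AVaR_γ(Y) μ_β(dγ) = p₀·AVaR_{u_β}(Y) + (1−β)^{-1} ∫_{(u_β,1)} AVaR_γ(Y) μ(dγ). -/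

import Mathlib

open MeasureTheory Set

/-- Cumulative distribution function `F_Y(x) = P(Y ≤ x)`. -/
noncomputable def cdfR {Ω : Type*} [MeasurableSpace Ω] (P : Measure Ω) (Y : Ω → ℝ)
    (x : ℝ) : ℝ :=
  (P {ω | Y ω ≤ x}).toReal

/-- Quantile function `F_Y⁻¹(u) = inf {x : F_Y(x) ≥ u}`. -/
noncomputable def quantR {Ω : Type*} [MeasurableSpace Ω] (P : Measure Ω) (Y : Ω → ℝ)
    (u : ℝ) : ℝ :=
  sInf {x : ℝ | u ≤ cdfR P Y x}

/-- Average value-at-risk `AVaR_α(Y) = (1-α)⁻¹ ∫_α^1 F_Y⁻¹(u) du`. -/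
noncomputable def avarR {Ω : Type*} [MeasurableSpace Ω] (P : Measure Ω) (α : ℝ)
    (Y : Ω → ℝ) : ℝ :=
  (1 - α)⁻¹ * ∫ u in α..1, quantR P Y u


section helpers
open Filter Topology ProbabilityTheory

theorem cdfR_eq {Ω : Type*} [MeasurableSpace Ω] (P : Measure Ω) [IsProbabilityMeasure P]
    (Y : Ω → ℝ) (hY : AEMeasurable Y P) (x : ℝ) : cdfR P Y x = cdf (P.map Y) x := by
  have := Measure.isProbabilityMeasure_map hY
  rw [cdf_eq_real, Measure.real, Measure.map_apply_of_aemeasurable hY measurableSet_Iic]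
  rfl

theorem quant_set {Ω : Type*} [MeasurableSpace Ω] (P : Measure Ω) [IsProbabilityMeasure P]
    (Y : Ω → ℝ) (hY : AEMeasurable Y P) {u : ℝ} (hu : u ∈ Ioo (0 : ℝ) 1) :
    {x : ℝ | u ≤ cdfR P Y x} = Ici (quantR P Y u) := by
  have hF : cdfR P Y = cdf (P.map Y) := funext (cdfR_eq P Y hY)
  have hm : Monotone (cdfR P Y) := by rw [hF]; exact monotone_cdf _
  have hne : {x : ℝ | u ≤ cdfR P Y x}.Nonempty := by
    have h := (tendsto_cdf_atTop (P.map Y)).eventually_const_le hu.2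
    obtain ⟨x, hx⟩ := h.exists
    exact ⟨x, by simpa [hF] using hx⟩
  have hbd : BddBelow {x : ℝ | u ≤ cdfR P Y x} := by
    have h := (tendsto_cdf_atBot (P.map Y)).eventually_lt_const hu.1
    obtain ⟨x, hx⟩ := h.exists
    refine ⟨x, fun y hy => ?_⟩
    by_contra hlt
    push Not at hlt
    have h1 := hm hlt.le
    have h2 : u ≤ cdfR P Y y := hy
    rw [← hF] at hx
    linarith
  have hgt : ∀ y, quantR P Y u < y → u ≤ cdfR P Y y := by
    intro y hy
    obtain ⟨z, hz, hzy⟩ := exists_lt_of_csInf_lt hne hy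
    exact le_trans hz (hm hzy.le)
  have hmem : u ≤ cdfR P Y (quantR P Y u) := by
    have hc : Tendsto (cdfR P Y) (𝓝[>] (quantR P Y u)) (𝓝 (cdfR P Y (quantR P Y u))) := by
      rw [hF]
      exact ((cdf (P.map Y)).right_continuous _).mono Ioi_subset_Ici_self
    refine ge_of_tendsto hc ?_
    filter_upwards [self_mem_nhdsWithin] with y hy using hgt y hy
  ext x
  constructor
  · intro hx; exact csInf_le hbd hx
  · intro hx; exact le_trans hmem (hm hx)

theorem quant_le_iff {Ω : Type*} [MeasurableSpace Ω] (P : Measure Ω) [IsProbabilityMeasure P]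
    (Y : Ω → ℝ) (hY : AEMeasurable Y P) {u : ℝ} (hu : u ∈ Ioo (0 : ℝ) 1) (x : ℝ) :
    quantR P Y u ≤ x ↔ u ≤ cdfR P Y x := by
  have := quant_set P Y hY hu
  exact (Set.ext_iff.1 this x).symm

theorem quant_mono {Ω : Type*} [MeasurableSpace Ω] (P : Measure Ω) [IsProbabilityMeasure P]
    (Y : Ω → ℝ) (hY : AEMeasurable Y P) : MonotoneOn (quantR P Y) (Ioo 0 1) := by
  intro u hu v hv huv
  rw [quant_le_iff P Y hY hu]
  exact huv.trans ((quant_le_iff P Y hY hv _).1 le_rfl)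

theorem quant_int {Ω : Type*} [MeasurableSpace Ω] (P : Measure Ω) [IsProbabilityMeasure P]
    (Y : Ω → ℝ) (hY : Integrable Y P) : IntegrableOn (quantR P Y) (Ioo 0 1) := by
  have hYm := hY.aemeasurable
  have hq : AEMeasurable (quantR P Y) (volume.restrict (Ioo (0:ℝ) 1)) :=
    aemeasurable_restrict_of_monotoneOn measurableSet_Ioo (quant_mono P Y hYm)
  have := Measure.isProbabilityMeasure_map hYm
  have : IsProbabilityMeasure (volume.restrict (Ioo (0:ℝ) 1)) := ⟨by simp⟩
  have := Measure.isProbabilityMeasure_map hq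
  have hmap : (volume.restrict (Ioo (0:ℝ) 1)).map (quantR P Y) = P.map Y := by
    refine Measure.ext_of_Iic _ _ fun x => ?_
    rw [Measure.map_apply_of_aemeasurable hq measurableSet_Iic,
      Measure.restrict_apply' measurableSet_Ioo]
    have hF := cdfR_eq P Y hYm x
    have h1 : cdfR P Y x ≤ 1 := by rw [hF]; exact cdf_le_one _ _
    rw [← ofReal_cdf, ← hF]
    apply le_antisymm
    · calc _ ≤ volume (Ioc 0 (cdfR P Y x)) := by
            apply measure_mono
            rintro u ⟨hu, hu'⟩
            exact ⟨hu'.1, (quant_le_iff P Y hYm hu' x).1 hu⟩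
        _ = _ := by simp
    · calc _ = volume (Ioo 0 (cdfR P Y x)) := by simp
        _ ≤ _ := by
            apply measure_mono
            rintro u hu
            have hu' : u ∈ Ioo (0:ℝ) 1 := ⟨hu.1, hu.2.trans_le h1⟩
            exact ⟨(quant_le_iff P Y hYm hu' x).2 hu.2.le, hu'⟩
  have h2 : Integrable id ((volume.restrict (Ioo (0:ℝ) 1)).map (quantR P Y)) := by
    rw [hmap, integrable_map_measure aestronglyMeasurable_id hYm]
    exact hY
  rw [integrable_map_measure aestronglyMeasurable_id hq] at h2
  exact h2

theorem quant_ii {Ω : Type*} [MeasurableSpace Ω] (P : Measure Ω) [IsProbabilityMeasure P]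
    (Y : Ω → ℝ) (hY : Integrable Y P) {a b : ℝ} (ha : 0 ≤ a) (hab : a ≤ b) (hb : b ≤ 1) :
    IntervalIntegrable (quantR P Y) volume a b := by
  rw [intervalIntegrable_iff_integrableOn_Ioo_of_le hab]
  exact (quant_int P Y hY).mono_set (Ioo_subset_Ioo ha hb)

theorem quant_pos {Ω : Type*} [MeasurableSpace Ω] (P : Measure Ω) [IsProbabilityMeasure P]
    (Y : Ω → ℝ) (hY : AEMeasurable Y P) (t : ℝ) {u : ℝ} (hu : u ∈ Ioo (0 : ℝ) 1) :
    quantR P (fun ω => max (Y ω - t) 0) u = max (quantR P Y u - t) 0 := by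
  have hZ : AEMeasurable (fun ω => max (Y ω - t) 0) P :=
    (hY.sub_const t).max aemeasurable_const
  refine eq_of_forall_ge_iff fun x => ?_
  rw [quant_le_iff P _ hZ hu]
  rcases lt_or_ge x 0 with hx | hx
  · have h0 : cdfR P (fun ω => max (Y ω - t) 0) x = 0 := by
      have : {ω | max (Y ω - t) 0 ≤ x} = ∅ := by
        ext ω
        simp only [mem_ofPred_eq, mem_empty_iff_false, iff_false, not_le]
        exact lt_of_lt_of_le hx (le_max_right _ _)
      unfold cdfR; rw [this]; try simp
    rw [h0]
    constructor
    · intro h; linarith [hu.1]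
    · intro h; linarith [le_max_right (quantR P Y u - t) 0]
  · have h0 : cdfR P (fun ω => max (Y ω - t) 0) x = cdfR P Y (x + t) := by
      have : {ω | max (Y ω - t) 0 ≤ x} = {ω | Y ω ≤ x + t} := by
        ext ω
        simp [hx]
      unfold cdfR; rw [this]; try simp
    rw [h0, ← quant_le_iff P Y hY hu]
    simp [hx]

theorem quant_abs {Ω : Type*} [MeasurableSpace Ω] (P : Measure Ω) [IsProbabilityMeasure P]
    (Y : Ω → ℝ) (hY : AEMeasurable Y P) {u : ℝ} (hu : u ∈ Ioo (0 : ℝ) 1) :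
    quantR P Y u ≤ quantR P (fun ω => |Y ω|) u := by
  have hZ : AEMeasurable (fun ω => |Y ω|) P := hY.abs
  rw [quant_le_iff P Y hY hu]
  refine ((quant_le_iff P _ hZ hu _).1 le_rfl).trans ?_
  apply ENNReal.toReal_mono (measure_ne_top _ _)
  apply measure_mono
  intro ω hω
  have hω' : |Y ω| ≤ quantR P (fun ω => |Y ω|) u := hω
  exact (le_abs_self (Y ω)).trans hω'

theorem quant_abs_nonneg {Ω : Type*} [MeasurableSpace Ω] (P : Measure Ω) [IsProbabilityMeasure P]
    (Y : Ω → ℝ) (hY : AEMeasurable Y P) {u : ℝ} (hu : u ∈ Ioo (0 : ℝ) 1) :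
    0 ≤ quantR P (fun ω => |Y ω|) u := by
  have hZ : AEMeasurable (fun ω => |Y ω|) P := hY.abs
  by_contra hlt
  push Not at hlt
  have h := (quant_le_iff P _ hZ hu _).1 le_rfl
  have h0 : cdfR P (fun ω => |Y ω|) (quantR P (fun ω => |Y ω|) u) = 0 := by
    have : {ω | |Y ω| ≤ quantR P (fun ω => |Y ω|) u} = ∅ := by
      ext ω
      simp only [mem_ofPred_eq, mem_empty_iff_false, iff_false, not_le]
      exact lt_of_lt_of_le hlt (abs_nonneg _)
    unfold cdfR; rw [this]; try simp
  linarith [hu.1]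

theorem avar_meas {Ω : Type*} [MeasurableSpace Ω] (P : Measure Ω) [IsProbabilityMeasure P]
    (Y : Ω → ℝ) (hY : Integrable Y P) (μ : Measure ℝ) (hμ : ∀ᵐ γ ∂μ, γ ∈ Ico (0 : ℝ) 1) :
    AEStronglyMeasurable (fun γ => avarR P γ Y) μ := by
  have hi : Integrable ((Ioo (0:ℝ) 1).indicator (quantR P Y)) :=
    (integrable_indicator_iff measurableSet_Ioo).2 (quant_int P Y hY)
  have hc : Continuous fun γ : ℝ => ∫ u in (1:ℝ)..γ, (Ioo (0:ℝ) 1).indicator (quantR P Y) u :=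
    intervalIntegral.continuous_primitive (fun a b => hi.intervalIntegrable) 1
  have hm : Measurable fun γ : ℝ => (1 - γ)⁻¹ *
      (-(∫ u in (1:ℝ)..γ, (Ioo (0:ℝ) 1).indicator (quantR P Y) u)) := by
    have := hc.measurable
    fun_prop
  refine hm.aestronglyMeasurable.congr ?_
  filter_upwards [hμ] with γ hγ
  unfold avarR
  rw [← intervalIntegral.integral_symm]
  congr 1
  apply intervalIntegral.integral_congr_Ioo_of_le hγ.2.le
  intro u hu
  have hu' : u ∈ Ioo (0:ℝ) 1 := ⟨hγ.1.trans_lt hu.1, hu.2⟩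
  exact indicator_of_mem hu' _

theorem avar_mono {Ω : Type*} [MeasurableSpace Ω] (P : Measure Ω)
    (Y : Ω → ℝ) (g : ℝ → ℝ) {γ : ℝ} (hγ : γ < 1)
    (hY : IntervalIntegrable (quantR P Y) volume γ 1)
    (hg : IntervalIntegrable g volume γ 1) (h : ∀ u ∈ Ioo γ 1, quantR P Y u ≤ g u) :
    avarR P γ Y ≤ (1 - γ)⁻¹ * ∫ u in γ..1, g u := by
  unfold avarR
  have : 0 ≤ (1 - γ)⁻¹ := by rw [inv_nonneg]; linarith
  exact mul_le_mul_of_nonneg_left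
    (intervalIntegral.integral_mono_on_of_le_Ioo hγ.le hY hg h) this

theorem avar_mono' {Ω : Type*} [MeasurableSpace Ω] (P : Measure Ω)
    (Y : Ω → ℝ) (g : ℝ → ℝ) {γ : ℝ} (hγ : γ < 1)
    (hY : IntervalIntegrable (quantR P Y) volume γ 1)
    (hg : IntervalIntegrable g volume γ 1) (h : ∀ u ∈ Ioo γ 1, g u ≤ quantR P Y u) :
    (1 - γ)⁻¹ * ∫ u in γ..1, g u ≤ avarR P γ Y := by
  unfold avarR
  have : 0 ≤ (1 - γ)⁻¹ := by rw [inv_nonneg]; linarith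
  exact mul_le_mul_of_nonneg_left
    (intervalIntegral.integral_mono_on_of_le_Ioo hγ.le hg hY h) this


theorem avar_pos_eq {Ω : Type*} [MeasurableSpace Ω] (P : Measure Ω) [IsProbabilityMeasure P]
    (Y : Ω → ℝ) (hY : Integrable Y P) (t : ℝ) {γ : ℝ} (hγ : γ ∈ Ico (0:ℝ) 1) :
    avarR P γ (fun ω => max (Y ω - t) 0) =
      (1 - γ)⁻¹ * ∫ u in γ..1, max (quantR P Y u - t) 0 := by
  unfold avarR
  congr 1
  apply intervalIntegral.integral_congr_Ioo_of_le hγ.2.le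
  intro u hu
  exact quant_pos P Y hY.aemeasurable t ⟨hγ.1.trans_lt hu.1, hu.2⟩

theorem pos_ii {Ω : Type*} [MeasurableSpace Ω] (P : Measure Ω) [IsProbabilityMeasure P]
    (Y : Ω → ℝ) (hY : Integrable Y P) (t : ℝ) {a b : ℝ} (ha : 0 ≤ a) (hab : a ≤ b) (hb : b ≤ 1) :
    IntervalIntegrable (fun u => max (quantR P Y u - t) 0) volume a b := by
  have h := (quant_ii P Y hY ha hab hb).sub (intervalIntegrable_const (c := t))
  rw [intervalIntegrable_iff] at h ⊢
  exact h.pos_part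

theorem sub_int {Ω : Type*} [MeasurableSpace Ω] (P : Measure Ω) [IsProbabilityMeasure P]
    (Y : Ω → ℝ) (hY : Integrable Y P) (t : ℝ) {a : ℝ} (ha : a ∈ Ico (0:ℝ) 1) :
    ∫ u in a..1, (quantR P Y u - t) = (1 - a) * (avarR P a Y - t) := by
  rw [intervalIntegral.integral_sub (quant_ii P Y hY ha.1 ha.2.le le_rfl)
    intervalIntegrable_const]
  have : (1 - a) ≠ 0 := by linarith [ha.2]
  unfold avarR
  simp
  field_simp

theorem le_pos_int {Ω : Type*} [MeasurableSpace Ω] (P : Measure Ω) [IsProbabilityMeasure P]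
    (Y : Ω → ℝ) (hY : Integrable Y P) (t : ℝ) {a : ℝ} (ha : a ∈ Ico (0:ℝ) 1) :
    (1 - a) * (avarR P a Y - t) ≤ ∫ u in a..1, max (quantR P Y u - t) 0 := by
  rw [← sub_int P Y hY t ha]
  apply intervalIntegral.integral_mono_on_of_le_Ioo ha.2.le
  · exact (quant_ii P Y hY ha.1 ha.2.le le_rfl).sub intervalIntegrable_const
  · exact pos_ii P Y hY t ha.1 ha.2.le le_rfl
  · intro u _; exact le_max_left _ _

theorem eq_pos_int {Ω : Type*} [MeasurableSpace Ω] (P : Measure Ω) [IsProbabilityMeasure P]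
    (Y : Ω → ℝ) (hY : Integrable Y P) {a b : ℝ} (hb : b ∈ Ioo (0:ℝ) 1) (hba : b ≤ a) (ha : a < 1) :
    (1 - a) * (avarR P a Y - quantR P Y b) =
      ∫ u in a..1, max (quantR P Y u - quantR P Y b) 0 := by
  rw [← sub_int P Y hY _ ⟨hb.1.le.trans hba, ha⟩]
  apply intervalIntegral.integral_congr_Ioo_of_le ha.le
  intro u hu
  have hu' : b < u := hba.trans_lt hu.1
  have := quant_mono P Y hY.aemeasurable hb ⟨hb.1.trans hu', hu.2⟩ hu'.le
  exact (max_eq_left (by linarith)).symm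

/-- the pointwise lower bound -/
noncomputable def lowB {Ω : Type*} [MeasurableSpace Ω] (P : Measure Ω) (Y : Ω → ℝ) (b t γ : ℝ) : ℝ :=
  (1 - b) * (avarR P b Y - t) * (Icc (0:ℝ) b).indicator (fun α => (1 - α)⁻¹) γ +
    (Ioo b 1).indicator (fun γ => avarR P γ Y - t) γ

theorem lowB_le {Ω : Type*} [MeasurableSpace Ω] (P : Measure Ω) [IsProbabilityMeasure P]
    (Y : Ω → ℝ) (hY : Integrable Y P) {b : ℝ} (hb : b ∈ Ioo (0:ℝ) 1) (t : ℝ)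
    {γ : ℝ} (hγ : γ ∈ Ico (0:ℝ) 1) :
    lowB P Y b t γ ≤ avarR P γ (fun ω => max (Y ω - t) 0) := by
  rw [avar_pos_eq P Y hY t hγ]
  have hpos : 0 < 1 - γ := by linarith [hγ.2]
  have hpos' : 0 ≤ (1 - γ)⁻¹ := by positivity
  unfold lowB
  rcases le_or_gt γ b with h | h
  · have h1 : γ ∈ Icc (0:ℝ) b := ⟨hγ.1, h⟩
    have h2 : γ ∉ Ioo b 1 := fun h' => absurd h'.1 (not_lt.2 h)
    rw [indicator_of_mem h1, indicator_of_notMem h2, add_zero, mul_comm]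
    apply mul_le_mul_of_nonneg_left _ hpos'
    refine (le_pos_int P Y hY t ⟨hb.1.le, hb.2⟩).trans ?_
    rw [← intervalIntegral.integral_add_adjacent_intervals (pos_ii P Y hY t hγ.1 h hb.2.le)
      (pos_ii P Y hY t hb.1.le hb.2.le le_rfl)]
    have : 0 ≤ ∫ u in γ..b, max (quantR P Y u - t) 0 :=
      intervalIntegral.integral_nonneg h (fun u _ => le_max_right _ _)
    linarith
  · have h1 : γ ∉ Icc (0:ℝ) b := fun h' => absurd h'.2 (not_le.2 h)
    have h2 : γ ∈ Ioo b 1 := ⟨h, hγ.2⟩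
    rw [indicator_of_notMem h1, indicator_of_mem h2, mul_zero, zero_add]
    have := mul_le_mul_of_nonneg_left (le_pos_int P Y hY t hγ) hpos'
    rwa [← mul_assoc, inv_mul_cancel₀ hpos.ne', one_mul] at this

theorem lowB_eq {Ω : Type*} [MeasurableSpace Ω] (P : Measure Ω) [IsProbabilityMeasure P]
    (Y : Ω → ℝ) (hY : Integrable Y P) {b : ℝ} (hb : b ∈ Ioo (0:ℝ) 1)
    {γ : ℝ} (hγ : γ ∈ Ico (0:ℝ) 1) :
    lowB P Y b (quantR P Y b) γ = avarR P γ (fun ω => max (Y ω - quantR P Y b) 0) := by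
  rw [avar_pos_eq P Y hY _ hγ]
  have hpos : 0 < 1 - γ := by linarith [hγ.2]
  unfold lowB
  rcases le_or_gt γ b with h | h
  · have h1 : γ ∈ Icc (0:ℝ) b := ⟨hγ.1, h⟩
    have h2 : γ ∉ Ioo b 1 := fun h' => absurd h'.1 (not_lt.2 h)
    rw [indicator_of_mem h1, indicator_of_notMem h2, add_zero, mul_comm,
      eq_pos_int P Y hY hb le_rfl hb.2,
      ← intervalIntegral.integral_add_adjacent_intervals (pos_ii P Y hY _ hγ.1 h hb.2.le)
      (pos_ii P Y hY _ hb.1.le hb.2.le le_rfl)]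
    have : ∫ u in γ..b, max (quantR P Y u - quantR P Y b) 0 = ∫ u in γ..b, (0:ℝ) := by
      apply intervalIntegral.integral_congr_Ioo_of_le h
      intro u hu
      have := quant_mono P Y hY.aemeasurable ⟨hγ.1.trans_lt hu.1, hu.2.trans hb.2⟩ hb hu.2.le
      exact max_eq_right (by linarith)
    rw [this]
    simp
  · have h1 : γ ∉ Icc (0:ℝ) b := fun h' => absurd h'.2 (not_le.2 h)
    have h2 : γ ∈ Ioo b 1 := ⟨h, hγ.2⟩
    rw [indicator_of_notMem h1, indicator_of_mem h2, mul_zero, zero_add,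
      ← eq_pos_int P Y hY hb h.le hγ.2, ← mul_assoc, inv_mul_cancel₀ hpos.ne', one_mul]

theorem avar_pos_integrable {Ω : Type*} [MeasurableSpace Ω] (P : Measure Ω)
    [IsProbabilityMeasure P] (Y : Ω → ℝ) (hY : Integrable Y P) (t : ℝ) (μ : Measure ℝ)
    [IsProbabilityMeasure μ] (hμ : ∀ᵐ γ ∂μ, γ ∈ Ico (0 : ℝ) 1)
    (hfin : Integrable (fun γ => avarR P γ (fun ω => |Y ω|)) μ) :
    Integrable (fun γ => avarR P γ (fun ω => max (Y ω - t) 0)) μ := by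
  have hZ : Integrable (fun ω => max (Y ω - t) 0) P := (hY.sub (integrable_const t)).pos_part
  refine (hfin.add (integrable_const |t|)).mono' (avar_meas P _ hZ μ hμ) ?_
  filter_upwards [hμ] with γ hγ
  have hpos : 0 < 1 - γ := by linarith [hγ.2]
  have hpos' : 0 ≤ (1 - γ)⁻¹ := by positivity
  have hnn : 0 ≤ ∫ u in γ..1, max (quantR P Y u - t) 0 :=
    intervalIntegral.integral_nonneg hγ.2.le (fun u _ => le_max_right _ _)
  rw [avar_pos_eq P Y hY t hγ, Real.norm_of_nonneg (mul_nonneg hpos' hnn)]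
  have hA := quant_ii P _ hY.abs hγ.1 hγ.2.le le_rfl
  have h1 : ∫ u in γ..1, max (quantR P Y u - t) 0 ≤
      ∫ u in γ..1, (quantR P (fun ω => |Y ω|) u - (-|t|)) := by
    apply intervalIntegral.integral_mono_on_of_le_Ioo hγ.2.le
    · exact pos_ii P Y hY t hγ.1 hγ.2.le le_rfl
    · exact hA.sub intervalIntegrable_const
    · intro u hu
      have hu' : u ∈ Ioo (0:ℝ) 1 := ⟨hγ.1.trans_lt hu.1, hu.2⟩
      have h2 := quant_abs P Y hY.aemeasurable hu'
      have h3 := quant_abs_nonneg P Y hY.aemeasurable hu'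
      have h4 := neg_abs_le t
      have h5 := abs_nonneg t
      apply max_le <;> linarith
  rw [sub_int P _ hY.abs _ hγ] at h1
  have := mul_le_mul_of_nonneg_left h1 hpos'
  rw [← mul_assoc, inv_mul_cancel₀ hpos.ne', one_mul] at this
  simpa using this

theorem avar_integrable {Ω : Type*} [MeasurableSpace Ω] (P : Measure Ω)
    [IsProbabilityMeasure P] (Y : Ω → ℝ) (hY : Integrable Y P) (μ : Measure ℝ)
    [IsProbabilityMeasure μ] (hμ : ∀ᵐ γ ∂μ, γ ∈ Ico (0 : ℝ) 1)
    (hfin : Integrable (fun γ => avarR P γ (fun ω => |Y ω|)) μ) {b : ℝ} (hb : b ∈ Ioo (0:ℝ) 1) :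
    IntegrableOn (fun γ => avarR P γ Y) (Ioo b 1) μ := by
  have h := ((avar_pos_integrable P Y hY (quantR P Y b) μ hμ hfin).add
    (integrable_const (quantR P Y b))).integrableOn (s := Ioo b 1)
  refine h.congr_fun ?_ measurableSet_Ioo
  intro γ hγ
  have hγ' : γ ∈ Ico (0:ℝ) 1 := ⟨(hb.1.trans hγ.1).le, hγ.2⟩
  have h1 : γ ∉ Icc (0:ℝ) b := fun h' => absurd h'.2 (not_le.2 hγ.1)
  have := lowB_eq P Y hY hb hγ'
  simp only [Pi.add_apply]
  rw [← this, lowB, indicator_of_notMem h1, indicator_of_mem hγ]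
  ring

end helpers

theorem stmt7 {Ω : Type*} [MeasurableSpace Ω] (P : Measure Ω) [IsProbabilityMeasure P]
    (μ : Measure ℝ) [IsProbabilityMeasure μ] (hμsupp : μ (Set.Ico (0 : ℝ) 1)ᶜ = 0)
    (β : ℝ) (hβ : β ∈ Set.Ioo (0 : ℝ) 1)
    (uβ : ℝ) (huβ : uβ ∈ Set.Ico (0 : ℝ) 1)
    (huβeq : (∫ α, max 0 (uβ - α) / (1 - α) ∂μ) = β)
    (p₀ : ℝ) (hp₀ : p₀ = (1 - uβ) / (1 - β) * ∫ α in Set.Icc (0 : ℝ) uβ, (1 - α)⁻¹ ∂μ)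
    (μβ : Measure ℝ)
    (hμβ : μβ = ENNReal.ofReal p₀ • Measure.dirac uβ +
      ENNReal.ofReal ((1 - β)⁻¹) • μ.restrict (Set.Ioo uβ 1))
    (Y : Ω → ℝ) (hYint : Integrable Y P)
    (hfin : Integrable (fun γ => avarR P γ (fun ω => |Y ω|)) μ) :
    IsProbabilityMeasure μβ ∧
    (⨅ t : ℝ, t + (1 - β)⁻¹ * ∫ γ, avarR P γ (fun ω => max (Y ω - t) 0) ∂μ) =
      ∫ γ, avarR P γ Y ∂μβ ∧
    (∫ γ, avarR P γ Y ∂μβ) =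
      p₀ * avarR P uβ Y + (1 - β)⁻¹ * ∫ γ in Set.Ioo uβ 1, avarR P γ Y ∂μ := by
  have hae : ∀ᵐ γ ∂μ, γ ∈ Ico (0 : ℝ) 1 := hμsupp
  have hc : 0 < 1 - β := by linarith [hβ.2]
  have hu0 : 0 < uβ := by
    rcases huβ.1.eq_or_lt with h | h
    · exfalso
      have : (∫ α, max 0 (uβ - α) / (1 - α) ∂μ) = ∫ α, (0:ℝ) ∂μ := by
        apply integral_congr_ae
        filter_upwards [hae] with γ hγ
        rw [max_eq_left (by linarith [hγ.1]), zero_div]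
      rw [this] at huβeq
      simp at huβeq
      linarith [hβ.1]
    · exact h
  have hb : uβ ∈ Ioo (0:ℝ) 1 := ⟨hu0, huβ.2⟩
  have hGon : IntegrableOn (fun α : ℝ => (1 - α)⁻¹) (Icc (0:ℝ) uβ) μ := by
    apply ContinuousOn.integrableOn_compact isCompact_Icc
    apply ContinuousOn.inv₀ (by fun_prop)
    intro x hx
    linarith [hx.2, hb.2]
  have hG : Integrable ((Icc (0:ℝ) uβ).indicator (fun α : ℝ => (1 - α)⁻¹)) μ :=
    hGon.integrable_indicator measurableSet_Icc
  have hGint := integral_indicator (μ := μ) (f := fun α : ℝ => (1 - α)⁻¹)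
    (measurableSet_Icc (a := (0:ℝ)) (b := uβ))
  set A := ∫ α in Set.Icc (0 : ℝ) uβ, (1 - α)⁻¹ ∂μ with hA
  have hA0 : 0 ≤ A := by
    apply setIntegral_nonneg measurableSet_Icc
    intro x hx
    rw [inv_nonneg]
    linarith [hx.2, hb.2]
  have hkey : (1 - uβ) * A + μ.real (Ioo uβ 1) = 1 - β := by
    have hw : Integrable (fun α => max 0 (uβ - α) / (1 - α)) μ := by
      by_contra hn
      rw [integral_undef hn] at huβeq
      linarith [hβ.1]
    have h1 : ∫ α, (1 - max 0 (uβ - α) / (1 - α)) ∂μ = 1 - β := by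
      rw [integral_sub (integrable_const _) hw, huβeq]
      simp
    have h2 : ∫ α, (1 - max 0 (uβ - α) / (1 - α)) ∂μ =
        ∫ α, ((1 - uβ) * (Icc (0:ℝ) uβ).indicator (fun α : ℝ => (1 - α)⁻¹) α +
          (Ioo uβ 1).indicator (fun _ => (1:ℝ)) α) ∂μ := by
      apply integral_congr_ae
      filter_upwards [hae] with γ hγ
      have hpos : 1 - γ ≠ 0 := by linarith [hγ.2]
      rcases le_or_gt γ uβ with h | h
      · have h1 : γ ∈ Icc (0:ℝ) uβ := ⟨hγ.1, h⟩
        have h2 : γ ∉ Ioo uβ 1 := fun h' => absurd h'.1 (not_lt.2 h)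
        rw [indicator_of_mem h1, indicator_of_notMem h2, add_zero, max_eq_right (by linarith)]
        field_simp
        ring
      · have h1 : γ ∉ Icc (0:ℝ) uβ := fun h' => absurd h'.2 (not_le.2 h)
        have h2 : γ ∈ Ioo uβ 1 := ⟨h, hγ.2⟩
        rw [indicator_of_notMem h1, indicator_of_mem h2, max_eq_left (by linarith)]
        simp
    rw [← h1, h2, integral_add (hG.const_mul _)
      ((integrable_const (1:ℝ)).indicator measurableSet_Ioo), integral_const_mul, hGint,
      integral_indicator measurableSet_Ioo]
    simp
  have hYon := avar_integrable P Y hYint μ hae hfin hb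
  have hp0 : 0 ≤ p₀ := by
    rw [hp₀]
    have : 0 ≤ 1 - uβ := by linarith [hb.2]
    positivity
  have hsum : p₀ + (1 - β)⁻¹ * μ.real (Ioo uβ 1) = 1 := by
    rw [hp₀]
    field_simp
    linarith
  have hIeq : (∫ γ, avarR P γ Y ∂μβ) =
      p₀ * avarR P uβ Y + (1 - β)⁻¹ * ∫ γ in Set.Ioo uβ 1, avarR P γ Y ∂μ := by
    rw [hμβ, integral_add_measure, integral_smul_measure, integral_smul_measure, integral_dirac,
      ENNReal.toReal_ofReal hp0, ENNReal.toReal_ofReal (by positivity)]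
    · rfl
    · exact (integrable_dirac (by simp)).smul_measure ENNReal.ofReal_ne_top
    · exact Integrable.smul_measure hYon ENNReal.ofReal_ne_top
  have hLi : ∀ t, Integrable (lowB P Y uβ t) μ := by
    intro t
    refine (hG.const_mul _).add ?_
    exact (hYon.sub (integrable_const t).integrableOn).integrable_indicator measurableSet_Ioo
  have hL : ∀ t, t + (1 - β)⁻¹ * ∫ γ, lowB P Y uβ t γ ∂μ =
      p₀ * avarR P uβ Y + (1 - β)⁻¹ * ∫ γ in Set.Ioo uβ 1, avarR P γ Y ∂μ := by
    intro t
    have h1 : ∫ γ, lowB P Y uβ t γ ∂μ = (1 - uβ) * (avarR P uβ Y - t) * A +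
        ((∫ γ in Set.Ioo uβ 1, avarR P γ Y ∂μ) - μ.real (Ioo uβ 1) * t) := by
      have hI : Integrable ((Ioo uβ 1).indicator (fun γ => avarR P γ Y - t)) μ :=
        (hYon.sub (integrable_const t).integrableOn).integrable_indicator measurableSet_Ioo
      unfold lowB
      rw [integral_add (hG.const_mul _) hI,
        integral_const_mul, hGint, integral_indicator measurableSet_Ioo,
        integral_sub hYon (integrable_const t).integrableOn]
      simp
    rw [h1, hp₀]
    have h3 : μ.real (Ioo uβ 1) = 1 - β - (1 - uβ) * A := by linarith
    rw [h3]
    field_simp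
    ring
  have hlow : ∀ t, p₀ * avarR P uβ Y + (1 - β)⁻¹ * ∫ γ in Set.Ioo uβ 1, avarR P γ Y ∂μ ≤
      t + (1 - β)⁻¹ * ∫ γ, avarR P γ (fun ω => max (Y ω - t) 0) ∂μ := by
    intro t
    rw [← hL t]
    have : ∫ γ, lowB P Y uβ t γ ∂μ ≤ ∫ γ, avarR P γ (fun ω => max (Y ω - t) 0) ∂μ := by
      apply integral_mono_ae (hLi t) (avar_pos_integrable P Y hYint t μ hae hfin)
      filter_upwards [hae] with γ hγ using lowB_le P Y hYint hb t hγ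
    have h2 : 0 ≤ (1 - β)⁻¹ := by positivity
    have := mul_le_mul_of_nonneg_left this h2
    linarith
  refine ⟨⟨?_⟩, ?_, hIeq⟩
  · have h1 : μ (Ioo uβ 1) = ENNReal.ofReal (μ.real (Ioo uβ 1)) := by simp [ofReal_measureReal]
    rw [hμβ]
    simp only [Measure.add_apply, Measure.smul_apply, smul_eq_mul, Measure.restrict_apply_univ,
      measure_univ, mul_one]
    rw [h1, ← ENNReal.ofReal_mul (by positivity), ← ENNReal.ofReal_add hp0 (by positivity), hsum,
      ENNReal.ofReal_one]
  · rw [hIeq]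
    apply le_antisymm
    · refine (ciInf_le ⟨?_, ?_⟩ (quantR P Y uβ)).trans ?_
      · exact p₀ * avarR P uβ Y + (1 - β)⁻¹ * ∫ γ in Set.Ioo uβ 1, avarR P γ Y ∂μ
      · rintro _ ⟨t, rfl⟩
        exact hlow t
      · rw [← hL (quantR P Y uβ)]
        apply le_of_eq
        congr 2
        apply integral_congr_ae
        filter_upwards [hae] with γ hγ using (lowB_eq P Y hYint hb hγ).symm
    · exact le_ciInf hlow
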